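/- Integrality property of μ: for any continuous path A : [0,1] → Sp(E) of symplectic automorphisms of a real symplectic vector space (E, ω) with A(0) = I, the number μ(A) + (1/2) dim ker(A(1) − I) is an integer. -/

import Mathlib

open LinearMap (BilinForm)

variable {E : Type*} [NormedAddCommGroup E] [NormedSpace ℝ E]

/-- A subspace is Lagrangian iff it equals its symplectic orthogonal. -/
def IsLagrangian (ω : BilinForm ℝ E) (L : Submodule ℝ E) : Prop :=
  LinearMap.BilinForm.orthogonal ω L = L

/-- Maximal dimension of a subspace on which the function `Q` is positive away from `0`. -/
noncomputable def posIndex {V : Type*} [AddCommGroup V] [Module ℝ V] (Q : V → ℝ) : ℕ :=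
  sSup {d : ℕ | ∃ W : Submodule ℝ V, Module.finrank ℝ W = d ∧ ∀ x ∈ W, x ≠ 0 → 0 < Q x}

/-- The quadratic form `Q(L1,L2,L3)` of a triplet of subspaces,
`Q(x1,x2,x3) = ω(x1,x2) + ω(x2,x3) + ω(x3,x1)`. -/
def tripleQ (ω : BilinForm ℝ E) (L1 L2 L3 : Submodule ℝ E) (v : L1 × L2 × L3) : ℝ :=
  ω v.1 v.2.1 + ω v.2.1 v.2.2 + ω v.2.2 v.1

/-- The signature `s(L1,L2,L3)` of a triplet of subspaces: the signature (number of positive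
squares minus number of negative squares in a diagonalization) of `Q(L1,L2,L3)`. -/
noncomputable def tripleSig (ω : BilinForm ℝ E) (L1 L2 L3 : Submodule ℝ E) : ℤ :=
  (posIndex (tripleQ ω L1 L2 L3) : ℤ) - (posIndex (fun v => - tripleQ ω L1 L2 L3 v) : ℤ)

/-- A continuous path of Lagrangian subspaces of `(E, ω)` on the interval `[a,b]`:  a family
`(L t)` of Lagrangian subspaces such that every `t0 ∈ [a,b]` has a neighbourhood `U` in `[a,b]`
on which there is a continuous family of idempotent linear maps of `E` with range `L t`. -/
structure IsLagrangianPath (ω : BilinForm ℝ E) (a b : ℝ) (L : ℝ → Submodule ℝ E) : Prop where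
  lag : ∀ t ∈ Set.Icc a b, IsLagrangian ω (L t)
  locTriv : ∀ t0 ∈ Set.Icc a b, ∃ U ∈ nhdsWithin t0 (Set.Icc a b), U ⊆ Set.Icc a b ∧
    ∃ P : ℝ → E →L[ℝ] E, ContinuousOn P U ∧
      ∀ t ∈ U, (P t).comp (P t) = P t ∧ LinearMap.range (P t : E →ₗ[ℝ] E) = L t

/-- A jointly continuous two-parameter family `(L s t)`, `s ∈ [0,1]`, `t ∈ [a,b]`, of Lagrangian
subspaces (a homotopy of paths of Lagrangian subspaces). -/
structure IsLagrangianHomotopy (ω : BilinForm ℝ E) (a b : ℝ)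
    (L : ℝ → ℝ → Submodule ℝ E) : Prop where
  lag : ∀ s ∈ Set.Icc (0:ℝ) 1, ∀ t ∈ Set.Icc a b, IsLagrangian ω (L s t)
  locTriv : ∀ p ∈ Set.Icc (0:ℝ) 1 ×ˢ Set.Icc a b,
    ∃ U ∈ nhdsWithin p (Set.Icc (0:ℝ) 1 ×ˢ Set.Icc a b),
      U ⊆ Set.Icc (0:ℝ) 1 ×ˢ Set.Icc a b ∧
      ∃ P : ℝ × ℝ → E →L[ℝ] E, ContinuousOn P U ∧
        ∀ q ∈ U, (P q).comp (P q) = P q ∧ LinearMap.range (P q : E →ₗ[ℝ] E) = L q.1 q.2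

/-- Admissible data for a pair of paths of Lagrangian subspaces on `[a,b]`:  a partition
`a = t_0 ≤ t_1 ≤ … ≤ t_k = b` together with Lagrangian subspaces `M_1, …, M_k` such that
`M_ν ∩ L_i(t) = 0` for all `t ∈ [t_{ν-1}, t_ν]`, `i = 1,2`.  (Here `M (ν+1)` plays the role
of `M_{ν+1}` for `0 ≤ ν < k`.) -/
structure AdmissibleData (ω : BilinForm ℝ E) (a b : ℝ) (L1 L2 : ℝ → Submodule ℝ E) where
  k : ℕ
  kpos : 0 < k
  t : ℕ → ℝ
  M : ℕ → Submodule ℝ E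
  ht0 : t 0 = a
  htk : t k = b
  hmono : ∀ ν < k, t ν ≤ t (ν + 1)
  hlag : ∀ ν < k, IsLagrangian ω (M (ν + 1))
  htrans1 : ∀ ν < k, ∀ s ∈ Set.Icc (t ν) (t (ν + 1)), M (ν + 1) ⊓ L1 s = ⊥
  htrans2 : ∀ ν < k, ∀ s ∈ Set.Icc (t ν) (t (ν + 1)), M (ν + 1) ⊓ L2 s = ⊥

/-- The expression `(1/2) Σ_ν ( s(L1(t_{ν-1}), L2(t_{ν-1}), M_ν) − s(L1(t_ν), L2(t_ν), M_ν) )`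
computed from admissible data; by well-definedness this is the intersection number `[L1 : L2]`. -/
noncomputable def dataSum {ω : BilinForm ℝ E} {a b : ℝ} {L1 L2 : ℝ → Submodule ℝ E}
    (D : AdmissibleData ω a b L1 L2) : ℝ :=
  (1 / 2 : ℝ) * ∑ ν ∈ Finset.range D.k,
    ((tripleSig ω (L1 (D.t ν)) (L2 (D.t ν)) (D.M (ν + 1)) : ℝ)
      - (tripleSig ω (L1 (D.t (ν + 1))) (L2 (D.t (ν + 1))) (D.M (ν + 1)) : ℝ))

/-- A continuous path of symplectic automorphisms of `(E, ω)` on `[a,b]`. -/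
structure IsSymplecticPath (ω : BilinForm ℝ E) (a b : ℝ) (A : ℝ → E →L[ℝ] E) : Prop where
  bij : ∀ t ∈ Set.Icc a b, Function.Bijective (A t)
  symp : ∀ t ∈ Set.Icc a b, ∀ x y, ω (A t x) (A t y) = ω x y
  cont : ContinuousOn A (Set.Icc a b)

/-- The symplectic form of `E × E⁻`: `((x1,x2),(y1,y2)) ↦ ω(x1,y1) − ω(x2,y2)`. -/
noncomputable def prodNegForm (ω : BilinForm ℝ E) : BilinForm ℝ (E × E) :=
  LinearMap.mk₂ ℝ (fun x y => ω x.1 y.1 - ω x.2 y.2)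
    (fun x x' y => by simp only [Prod.fst_add, Prod.snd_add, map_add, LinearMap.add_apply]; ring)
    (fun c x y => by
      simp only [Prod.smul_fst, Prod.smul_snd, map_smul, LinearMap.smul_apply, smul_eq_mul]; ring)
    (fun x y y' => by simp only [Prod.fst_add, Prod.snd_add, map_add]; ring)
    (fun c x y => by simp only [Prod.smul_fst, Prod.smul_snd, map_smul, smul_eq_mul]; ring)

/-- The graph `Γ_A = {(A x, x)}` of an endomorphism, as a subspace of `E × E`. -/
def graphSub (A : E →L[ℝ] E) : Submodule ℝ (E × E) :=
  LinearMap.range ((A : E →ₗ[ℝ] E).prod LinearMap.id)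

/-- The diagonal `Δ = {(x, x)}` in `E × E`. -/
def diagSub : Submodule ℝ (E × E) :=
  LinearMap.range ((LinearMap.id : E →ₗ[ℝ] E).prod LinearMap.id)

lemma posIndex_eq_sigPos {V : Type*} [AddCommGroup V] [Module ℝ V] [FiniteDimensional ℝ V]
    (Q : QuadraticForm ℝ V) : posIndex Q = sigPos Q := by
  have h := sigPos_isGreatest Q
  rw [posIndex, ← h.csSup_eq]
  congr 1
  ext d
  simp [QuadraticMap.PosDef]

/-- A bilinear form whose associated quadratic form is `tripleQ`. -/
noncomputable def tripleBilin (ω : BilinForm ℝ E) (L1 L2 L3 : Submodule ℝ E) :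
    BilinForm ℝ (L1 × L2 × L3) :=
  let p1 := L1.subtype ∘ₗ LinearMap.fst ℝ L1 (L2 × L3)
  let p2 := L2.subtype ∘ₗ LinearMap.fst ℝ L2 L3 ∘ₗ LinearMap.snd ℝ L1 (L2 × L3)
  let p3 := L3.subtype ∘ₗ LinearMap.snd ℝ L2 L3 ∘ₗ LinearMap.snd ℝ L1 (L2 × L3)
  ω.compl₁₂ p1 p2 + ω.compl₁₂ p2 p3 + ω.compl₁₂ p3 p1

lemma tripleBilin_apply (ω : BilinForm ℝ E) (L1 L2 L3 : Submodule ℝ E) (v w : L1 × L2 × L3) :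
    tripleBilin ω L1 L2 L3 v w = ω v.1 w.2.1 + ω v.2.1 w.2.2 + ω v.2.2 w.1 := rfl

/-- The quadratic form `tripleQ`, bundled. -/
noncomputable def tripleForm (ω : BilinForm ℝ E) (L1 L2 L3 : Submodule ℝ E) :
    QuadraticForm ℝ (L1 × L2 × L3) :=
  (tripleBilin ω L1 L2 L3).toQuadraticMap

lemma coe_tripleForm (ω : BilinForm ℝ E) (L1 L2 L3 : Submodule ℝ E) :
    ⇑(tripleForm ω L1 L2 L3) = tripleQ ω L1 L2 L3 := rfl

lemma tripleSig_eq [FiniteDimensional ℝ E] (ω : BilinForm ℝ E) (L1 L2 L3 : Submodule ℝ E) :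
    tripleSig ω L1 L2 L3 =
      (sigPos (tripleForm ω L1 L2 L3) : ℤ) - sigNeg (tripleForm ω L1 L2 L3) := by
  rw [tripleSig, ← sigPos_neg, ← posIndex_eq_sigPos, ← posIndex_eq_sigPos, coe_tripleForm]
  rfl

lemma mem_radical_tripleForm_iff {ω : BilinForm ℝ E} (L1 L2 L3 : Submodule ℝ E)
    (v : L1 × L2 × L3) :
    v ∈ (tripleForm ω L1 L2 L3).radical ↔
      ∀ w, tripleBilin ω L1 L2 L3 v w + tripleBilin ω L1 L2 L3 w v = 0 := by
  rw [QuadraticMap.mem_radical_iff']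
  simp only [tripleForm, LinearMap.BilinMap.toQuadraticMap_apply, map_add, LinearMap.add_apply]
  constructor
  · rintro ⟨h0, h⟩ w
    linarith [h w]
  · intro h
    have h0 : tripleBilin ω L1 L2 L3 v v = 0 := by linarith [h v]
    exact ⟨h0, fun w => by linarith [h w]⟩

lemma IsLagrangian.mem_iff {ω : BilinForm ℝ E} {L : Submodule ℝ E} (hL : IsLagrangian ω L)
    (x : E) : x ∈ L ↔ ∀ y ∈ L, ω y x = 0 := by
  conv_lhs => rw [← hL]
  exact LinearMap.BilinForm.mem_orthogonal_iff

/-- If `L3` is transversal to `L1` and `L2`, the radical of `Q(L1,L2,L3)` consists of the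
triples `(z, z, 0)` with `z ∈ L1 ∩ L2`. -/
lemma finrank_radical_tripleForm {ω : BilinForm ℝ E} (halt : LinearMap.IsAlt ω)
    {L1 L2 L3 : Submodule ℝ E} (h1 : IsLagrangian ω L1) (h2 : IsLagrangian ω L2)
    (h3 : IsLagrangian ω L3) (h31 : L3 ⊓ L1 = ⊥) (h32 : L3 ⊓ L2 = ⊥) :
    Module.finrank ℝ (tripleForm ω L1 L2 L3).radical = Module.finrank ℝ ↥(L1 ⊓ L2) := by
  let f : ↥(L1 ⊓ L2) →ₗ[ℝ] L1 × L2 × L3 :=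
    (Submodule.inclusion inf_le_left).prod ((Submodule.inclusion inf_le_right).prod 0)
  have hf : Function.Injective f := fun a b hab =>
    Submodule.inclusion_injective inf_le_left (congrArg Prod.fst hab)
  rw [← LinearMap.finrank_range_of_inj hf]
  suffices hrad : (tripleForm ω L1 L2 L3).radical = LinearMap.range f by rw [hrad]
  ext v
  rw [mem_radical_tripleForm_iff, LinearMap.mem_range]
  have hneg : ∀ x y, ω x y = - ω y x := fun x y => (halt.neg y x).symm
  constructor
  · obtain ⟨⟨a, ha⟩, ⟨b, hb⟩, ⟨c, hc⟩⟩ := v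
    simp only [tripleBilin_apply]
    intro h
    have e1 : b - c ∈ L1 := (h1.mem_iff _).2 fun y hy => by
      have := h (⟨y, hy⟩, 0, 0)
      simp at this
      rw [map_sub]; linarith [hneg c y]
    have e2 : c - a ∈ L2 := (h2.mem_iff _).2 fun y hy => by
      have := h (0, ⟨y, hy⟩, 0)
      simp at this
      rw [map_sub]; linarith [hneg a y]
    have e3 : a - b ∈ L3 := (h3.mem_iff _).2 fun y hy => by
      have := h (0, 0, ⟨y, hy⟩)
      simp at this
      rw [map_sub]; linarith [hneg b y]
    have k2 : b + c - a ∈ L3 ⊓ L2 := Submodule.mem_inf.2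
      ⟨(show c - (a - b) = b + c - a by abel) ▸ L3.sub_mem hc e3,
        (show b + (c - a) = b + c - a by abel) ▸ L2.add_mem hb e2⟩
    have k1 : c + a - b ∈ L3 ⊓ L1 := Submodule.mem_inf.2
      ⟨(show c + (a - b) = c + a - b by abel) ▸ L3.add_mem hc e3,
        (show a - (b - c) = c + a - b by abel) ▸ L1.sub_mem ha e1⟩
    rw [h32, Submodule.mem_bot] at k2
    rw [h31, Submodule.mem_bot] at k1
    have hc0 : c = 0 := by
      have : (2 : ℝ) • c = 0 := by
        rw [two_smul]
        calc c + c = (b + c - a) + (c + a - b) := by abel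
          _ = 0 := by rw [k1, k2, add_zero]
      simpa using this
    subst hc0
    have hab : a = b := by simpa [sub_eq_zero] using k1
    subst hab
    exact ⟨⟨a, ha, hb⟩, rfl⟩
  · rintro ⟨z, rfl⟩ w
    have hz1 := (h1.mem_iff z).1 z.2.1 w.1 w.1.2
    have hz2 := (h2.mem_iff z).1 z.2.2 w.2.1 w.2.1.2
    simp [f, tripleBilin_apply]
    linarith [hneg z w.2.1, hneg z w.2.2]

lemma tripleSig_parity [FiniteDimensional ℝ E] {ω : BilinForm ℝ E} (halt : LinearMap.IsAlt ω)
    {L1 L2 L3 : Submodule ℝ E} (h1 : IsLagrangian ω L1) (h2 : IsLagrangian ω L2)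
    (h3 : IsLagrangian ω L3) (h31 : L3 ⊓ L1 = ⊥) (h32 : L3 ⊓ L2 = ⊥) :
    Even (tripleSig ω L1 L2 L3 + Module.finrank ℝ ↥(L1 ⊓ L2) -
      (Module.finrank ℝ L1 + Module.finrank ℝ L2 + Module.finrank ℝ L3 : ℕ)) := by
  have h := QuadraticForm.sigPos_add_sigNeg_add_radical (Q := tripleForm ω L1 L2 L3)
  rw [finrank_radical_tripleForm halt h1 h2 h3 h31 h32, Module.finrank_prod,
    Module.finrank_prod] at h
  rw [tripleSig_eq]
  refine ⟨-(sigNeg (tripleForm ω L1 L2 L3) : ℤ), ?_⟩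
  push_cast
  lia

lemma finrank_even_of_isAlt_of_nondegenerate [FiniteDimensional ℝ E] {ω : BilinForm ℝ E}
    (halt : LinearMap.IsAlt ω) (hnd : LinearMap.BilinForm.Nondegenerate ω) :
    Even (Module.finrank ℝ E) := by
  let b := Module.finBasis ℝ E
  have hdet := (LinearMap.BilinForm.nondegenerate_iff_det_ne_zero b).1 hnd
  have hT : (LinearMap.BilinForm.toMatrix b ω).transpose = -LinearMap.BilinForm.toMatrix b ω := by
    ext i j
    simp only [Matrix.transpose_apply, Matrix.neg_apply, LinearMap.BilinForm.toMatrix_apply]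
    exact (halt.neg _ _).symm
  have h := congrArg Matrix.det hT
  rw [Matrix.det_transpose, Matrix.det_neg, Fintype.card_fin] at h
  by_contra hodd
  rw [Nat.not_even_iff_odd] at hodd
  rw [hodd.neg_one_pow] at h
  exact hdet (by linarith)

lemma prodNegForm_apply (ω : BilinForm ℝ E) (x y : E × E) :
    prodNegForm ω x y = ω x.1 y.1 - ω x.2 y.2 := rfl

lemma prodNegForm_isAlt {ω : BilinForm ℝ E} (halt : LinearMap.IsAlt ω) :
    LinearMap.IsAlt (prodNegForm ω) := fun x => by
  rw [prodNegForm_apply, halt x.1, halt x.2, sub_zero]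

lemma mem_graphSub {B : E →L[ℝ] E} {y : E × E} : y ∈ graphSub B ↔ B y.2 = y.1 := by
  constructor
  · rintro ⟨x, rfl⟩
    rfl
  · intro h
    exact ⟨y.2, Prod.ext h rfl⟩

lemma graphSub_id : graphSub (ContinuousLinearMap.id ℝ E) = diagSub := rfl

lemma graphSub_isLagrangian {ω : BilinForm ℝ E} (hnd : LinearMap.BilinForm.Nondegenerate ω)
    {B : E →L[ℝ] E} (hB : Function.Surjective B) (hs : ∀ x y, ω (B x) (B y) = ω x y) :
    IsLagrangian (prodNegForm ω) (graphSub B) := by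
  ext y
  rw [LinearMap.BilinForm.mem_orthogonal_iff]
  constructor
  · intro h
    obtain ⟨z, hz⟩ := hB y.1
    have hzy : z - y.2 = 0 := hnd.2 _ fun x => by
      have := h (B x, x) (mem_graphSub.2 rfl)
      rw [prodNegForm_apply, ← hz, hs] at this
      rw [map_sub, this]
    rw [mem_graphSub, ← hz, sub_eq_zero.1 hzy]
  · intro hy x hx
    rw [mem_graphSub] at hy hx
    rw [prodNegForm_apply, ← hy, ← hx, hs, sub_self]

lemma finrank_graphSub (B : E →L[ℝ] E) :
    Module.finrank ℝ (graphSub B) = Module.finrank ℝ E :=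
  LinearMap.finrank_range_of_inj fun _ _ h => congrArg Prod.snd h

lemma finrank_diagSub : Module.finrank ℝ (diagSub : Submodule ℝ (E × E)) = Module.finrank ℝ E :=
  finrank_graphSub (ContinuousLinearMap.id ℝ E)

lemma finrank_diagSub_inf_graphSub (B : E →L[ℝ] E) :
    Module.finrank ℝ ↥(diagSub ⊓ graphSub B) =
      Module.finrank ℝ ↥(LinearMap.ker ((B : E →ₗ[ℝ] E) - LinearMap.id)) := by
  let f : E →ₗ[ℝ] E × E := LinearMap.id.prod LinearMap.id
  have hf : Function.Injective f := fun _ _ h => congrArg Prod.fst h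
  rw [(Submodule.equivMapOfInjective f hf _).finrank_eq]
  suffices hmap : diagSub ⊓ graphSub B =
      (LinearMap.ker ((B : E →ₗ[ℝ] E) - LinearMap.id)).map f by rw [hmap]
  ext ⟨x, y⟩
  rw [Submodule.mem_inf, ← graphSub_id, mem_graphSub, mem_graphSub, Submodule.mem_map]
  constructor
  · rintro ⟨h1, h2⟩
    have h1 : y = x := h1
    subst h1
    exact ⟨y, by simpa [sub_eq_zero] using h2, rfl⟩
  · rintro ⟨z, hz, hzx⟩
    obtain ⟨rfl, rfl⟩ := Prod.mk.inj hzx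
    exact ⟨rfl, by simpa [sub_eq_zero] using hz⟩

lemma AdmissibleData.t_mem_Icc {ω : BilinForm ℝ E} {a b : ℝ} {L1 L2 : ℝ → Submodule ℝ E}
    (D : AdmissibleData ω a b L1 L2) {ν : ℕ} (hν : ν ≤ D.k) : D.t ν ∈ Set.Icc a b := by
  have hmono : MonotoneOn D.t (Set.Iic D.k) :=
    monotoneOn_of_le_add_one Set.ordConnected_Iic fun ν _ _ h => D.hmono ν h
  constructor
  · exact D.ht0.symm.trans_le (hmono (Nat.zero_le _) hν (Nat.zero_le _))
  · exact (hmono hν (Set.mem_Iic.2 le_rfl) hν).trans_eq D.htk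

/-- integrality of `μ`: for a continuous path `A : [0,1] → Sp(E)` with `A(0) = I`,
the number `μ(A) + (1/2) dim ker(A(1) − I)` is an integer, where `μ(A) = [const_Δ : Γ_{A(t)}]`
in `E × E⁻` is computed from arbitrary admissible data. -/
theorem mu_integrality [FiniteDimensional ℝ E]
    (ω : BilinForm ℝ E) (halt : LinearMap.IsAlt ω)
    (hnd : LinearMap.BilinForm.Nondegenerate ω)
    (A : ℝ → E →L[ℝ] E) (hA : IsSymplecticPath ω 0 1 A)
    (hA0 : A 0 = ContinuousLinearMap.id ℝ E)
    (D : AdmissibleData (prodNegForm ω) 0 1 (fun _ => diagSub)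
      (fun t => graphSub (A t))) :
    ∃ m : ℤ, dataSum D +
      (Module.finrank ℝ ↥(LinearMap.ker ((A 1 : E →ₗ[ℝ] E) - LinearMap.id)) : ℝ) / 2
        = (m : ℝ) := by
  let d : ℝ → ℤ := fun t =>
    Module.finrank ℝ ↥(LinearMap.ker ((A t : E →ₗ[ℝ] E) - LinearMap.id))
  let sig : ℕ → ℕ → ℤ := fun i ν =>
    tripleSig (prodNegForm ω) diagSub (graphSub (A (D.t i))) (D.M (ν + 1))
  have hdiag : IsLagrangian (prodNegForm ω) diagSub :=
    graphSub_isLagrangian hnd (B := ContinuousLinearMap.id ℝ E) Function.surjective_id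
      fun _ _ => rfl
  have hpar : ∀ ν < D.k, ∀ i ≤ D.k, D.t i ∈ Set.Icc (D.t ν) (D.t (ν + 1)) →
      Even (sig i ν + d (D.t i) -
        (Module.finrank ℝ E + Module.finrank ℝ E + Module.finrank ℝ (D.M (ν + 1)) : ℕ)) := by
    intro ν hν i hi ht
    have hti := D.t_mem_Icc hi
    have h := tripleSig_parity (prodNegForm_isAlt halt) hdiag
      (graphSub_isLagrangian hnd (hA.bij _ hti).2 (hA.symp _ hti)) (D.hlag ν hν)
      (D.htrans1 ν hν _ ht) (D.htrans2 ν hν _ ht)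
    rwa [finrank_diagSub_inf_graphSub, finrank_diagSub, finrank_graphSub] at h
  have hstep : ∀ ν ∈ Finset.range D.k,
      Even ((sig ν ν - sig (ν + 1) ν) + (d (D.t (ν + 1)) - d (D.t ν)) ) := by
    intro ν hν
    rw [Finset.mem_range] at hν
    have hle := D.hmono ν hν
    obtain ⟨p, hp⟩ := hpar ν hν ν hν.le ⟨le_rfl, hle⟩
    obtain ⟨q, hq⟩ := hpar ν hν (ν + 1) hν ⟨hle, le_rfl⟩
    exact ⟨p - q + d (D.t (ν + 1)) - d (D.t ν), by linarith⟩
  have hsum := Finset.even_sum _ hstep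
  rw [Finset.sum_add_distrib, Finset.sum_range_sub (fun ν => d (D.t ν)), D.htk, D.ht0] at hsum
  have hd0 : d 0 = Module.finrank ℝ E := by
    have hker : (A 0 : E →ₗ[ℝ] E) - LinearMap.id = 0 := by
      rw [hA0]
      exact sub_self _
    simp only [d]
    rw [hker, LinearMap.ker_zero, finrank_top]
  obtain ⟨n, hn⟩ := finrank_even_of_isAlt_of_nondegenerate halt hnd
  obtain ⟨m, hm⟩ := hsum
  refine ⟨m + n, ?_⟩
  have key : (∑ ν ∈ Finset.range D.k, (sig ν ν - sig (ν + 1) ν)) + d 1 = 2 * (m + n) := by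
    rw [hd0, hn] at hm
    push_cast at hm
    linarith
  have hD : dataSum D =
      (1 / 2 : ℝ) * ((∑ ν ∈ Finset.range D.k, (sig ν ν - sig (ν + 1) ν) : ℤ) : ℝ) := by
    rw [dataSum]
    push_cast
    rfl
  have hd1 : (Module.finrank ℝ ↥(LinearMap.ker ((A 1 : E →ₗ[ℝ] E) - LinearMap.id)) : ℝ) =
      ((d 1 : ℤ) : ℝ) := by
    simp [d]
  have keyR := congrArg (Int.cast : ℤ → ℝ) key
  rw [Int.cast_add] at keyR
  rw [hD, hd1]
  push_cast at keyR ⊢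
  linarith
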